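/- arXiv:2103.13509 — 2 statements merged into one kernel-verified Lean document; each statement's English description precedes it below -/
import Mathlib

section
/- Under Assumption A, suppose the prior is finite: q = Σ_{k=1}^K p_k δ_{v_k} with v_1, …, v_K ∈ ℝ^n, p_k > 0 and Σ_k p_k = 1. Then (w⋆, σ⋆) ∈ 𝒲 × Σ solves the infinite-dimensional variational inequality if and only if, writing σ⋆ᵏ = σ⋆(v_k), the tuple (w⋆, σ⋆¹, …, σ⋆ᴷ) ∈ 𝒲 × 𝒳^K satisfies the finite-dimensional variational inequality: Σ_{k=1}^K p_k [⟨w − w⋆, ∇_w θ_l(w⋆, σ⋆ᵏ)⟩ + ⟨σᵏ − σ⋆ᵏ, ∇_X̄ θ_d(w⋆, σ⋆ᵏ, v_k)⟩_F] ≥ 0 for all w ∈ 𝒲 and all σ¹, …, σᴷ ∈ 𝒳. -/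
open MeasureTheory Filter
open scoped RealInnerProductSpace

noncomputable section

/-- The learner's action space `ℝ^m`. -/
abbrev Wsp (m : ℕ) := EuclideanSpace ℝ (Fin m)

/-- The space `ℝ^n` of adversary weights `c_d`. -/
abbrev Csp (n : ℕ) := EuclideanSpace ℝ (Fin n)

/-- The space `ℝ^{n×m}` of data matrices, with the Frobenius (Euclidean) inner product. -/
abbrev Xsp (n m : ℕ) := EuclideanSpace ℝ (Fin n × Fin m)

/-- A strategy of the data generator: a measurable map `σ : ℝ^n → 𝒳` with
`𝔼_q[‖σ(c_d)‖_F²] < ∞`.  The set of all such maps is `Σ`. -/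
def IsStrategy {n m : ℕ} (𝒳 : Set (Xsp n m)) (q : Measure (Csp n))
    (σ : Csp n → Xsp n m) : Prop :=
  Measurable σ ∧ (∀ c, σ c ∈ 𝒳) ∧ Integrable (fun c => ‖σ c‖ ^ 2) q

/-- Assumption A of the paper: convexity, continuous differentiability (with the given
gradient maps `Dθl`, `Dθd`), measurability in `c_d`, the moment condition on the adversary's
gradient, and closedness/convexity of the action sets. -/
structure AssumptionA {m n : ℕ} (𝒲 : Set (Wsp m)) (𝒳 : Set (Xsp n m)) (q : Measure (Csp n))
    (θl : Wsp m → Xsp n m → ℝ) (θd : Wsp m → Xsp n m → Csp n → ℝ)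
    (Dθl : Wsp m → Xsp n m → Wsp m)
    (Dθd : Wsp m → Xsp n m → Csp n → Xsp n m) : Prop where
  convex_l : ∀ X ∈ 𝒳, ConvexOn ℝ Set.univ fun w => θl w X
  grad_l : ∀ X ∈ 𝒳, ∀ w, HasGradientAt (fun w' => θl w' X) (Dθl w X) w
  contGrad_l : ∀ X ∈ 𝒳, Continuous fun w => Dθl w X
  convex_d : ∀ w ∈ 𝒲, ∀ c, ConvexOn ℝ Set.univ fun X => θd w X c
  grad_d : ∀ w ∈ 𝒲, ∀ c X, HasGradientAt (fun X' => θd w X' c) (Dθd w X c) X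
  contGrad_d : ∀ w ∈ 𝒲, ∀ c, Continuous fun X => Dθd w X c
  meas_d : ∀ w X, Measurable fun c => θd w X c
  measGrad_d : ∀ w X, Measurable fun c => Dθd w X c
  intGrad_d : ∀ w ∈ 𝒲, ∀ X ∈ 𝒳, Integrable (fun c => ‖Dθd w X c‖ ^ 2) q
  W_nonempty : 𝒲.Nonempty
  W_closed : IsClosed 𝒲
  W_convex : Convex ℝ 𝒲
  X_nonempty : 𝒳.Nonempty
  X_closed : IsClosed 𝒳
  X_convex : Convex ℝ 𝒳

/-- `(wstar, σstar)` is a Bayesian equilibrium: `wstar` minimizes the learner's expected cost and,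
for `q`-a.e. `c_d`, `σstar(c_d)` minimizes the data generator's cost. -/
def IsBayesEq {m n : ℕ} (𝒲 : Set (Wsp m)) (𝒳 : Set (Xsp n m)) (q : Measure (Csp n))
    (θl : Wsp m → Xsp n m → ℝ) (θd : Wsp m → Xsp n m → Csp n → ℝ)
    (wstar : Wsp m) (σstar : Csp n → Xsp n m) : Prop :=
  (∀ w ∈ 𝒲, ∫ c, θl wstar (σstar c) ∂q ≤ ∫ c, θl w (σstar c) ∂q) ∧
  (∀ᵐ c ∂q, ∀ X ∈ 𝒳, θd wstar (σstar c) c ≤ θd wstar X c)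

/-- `(wstar, σstar)` solves the infinite-dimensional variational inequality (Eq. (4) of the paper). -/
def SolvesVI {m n : ℕ} (𝒲 : Set (Wsp m)) (𝒳 : Set (Xsp n m)) (q : Measure (Csp n))
    (Dθl : Wsp m → Xsp n m → Wsp m)
    (Dθd : Wsp m → Xsp n m → Csp n → Xsp n m)
    (wstar : Wsp m) (σstar : Csp n → Xsp n m) : Prop :=
  ∀ w ∈ 𝒲, ∀ σ : Csp n → Xsp n m, IsStrategy 𝒳 q σ →
    0 ≤ ∫ c, (⟪w - wstar, Dθl wstar (σstar c)⟫ + ⟪σ c - σstar c, Dθd wstar (σstar c) c⟫) ∂q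

/-- The integral against a finite combination of Dirac masses with nonnegative weights. -/
lemma integral_sum_ofReal_smul_dirac {α ι : Type*} [Fintype ι] [MeasurableSpace α]
    [MeasurableSingletonClass α] (v : ι → α) (p : ι → ℝ) (hp : ∀ k, 0 ≤ p k) (f : α → ℝ) :
    ∫ c, f c ∂(∑ k, ENNReal.ofReal (p k) • Measure.dirac (v k)) = ∑ k, p k * f (v k) := by
  rw [integral_finsetSum_measure fun k _ =>
    (integrable_dirac (by simp)).smul_measure ENNReal.ofReal_ne_top]
  simp [integral_smul_measure, ENNReal.toReal_ofReal (hp _)]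

/-- Every real function is integrable against a finite combination of Dirac masses. -/
lemma integrable_sum_ofReal_smul_dirac {α ι : Type*} [Fintype ι] [MeasurableSpace α]
    [MeasurableSingletonClass α] (v : ι → α) (p : ι → ℝ) (f : α → ℝ) :
    Integrable f (∑ k, ENNReal.ofReal (p k) • Measure.dirac (v k)) :=
  integrable_finsetSum_measure.2 fun _ _ =>
    (integrable_dirac (by simp)).smul_measure ENNReal.ofReal_ne_top

/-- Any finite assignment of values at distinct points extends to a measurable function with
values in a prescribed nonempty set. -/
lemma exists_measurable_extension {α β ι : Type*} [Finite ι] [MeasurableSpace α]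
    [MeasurableSingletonClass α] [MeasurableSpace β] {v : ι → α} (hv : Function.Injective v)
    {s : Set β} (hs : s.Nonempty) (g : ι → β) (hg : ∀ k, g k ∈ s) :
    ∃ f : α → β, Measurable f ∧ (∀ c, f c ∈ s) ∧ ∀ k, f (v k) = g k := by
  obtain ⟨x₀, hx₀⟩ := hs
  refine ⟨Function.extend v g fun _ => x₀, ?_, fun c => ?_, hv.extend_apply g _⟩
  · refine measurable_const.measurable_of_countable_ne (f := fun _ => x₀)
      ((Set.finite_range v).countable.mono fun c hc => ?_)
    by_contra h
    exact hc (Function.extend_apply' g (fun _ => x₀) c h).symm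
  · by_cases h : ∃ k, v k = c
    · obtain ⟨k, rfl⟩ := h
      rw [hv.extend_apply]
      exact hg k
    · rw [Function.extend_apply' _ _ _ h]
      exact hx₀

/-- Case I, finite Bayesian prior.  Under Assumption A, if the prior is
`q = Σ_k p_k δ_{v_k}` with distinct atoms `v_1, …, v_K`, `p_k > 0`, `Σ_k p_k = 1`, then
`(w⋆, σ⋆) ∈ 𝒲 × Σ` solves the infinite-dimensional variational inequality iff
`(w⋆, σ⋆(v_1), …, σ⋆(v_K))` satisfies the finite-dimensional variational inequality
(Eq. (7) of the paper). -/
theorem statement10 {m n K : ℕ} (hK : 0 < K)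
    (𝒲 : Set (Wsp m)) (𝒳 : Set (Xsp n m))
    (q : Measure (Csp n)) [IsProbabilityMeasure q]
    (θl : Wsp m → Xsp n m → ℝ) (θd : Wsp m → Xsp n m → Csp n → ℝ)
    (Dθl : Wsp m → Xsp n m → Wsp m) (Dθd : Wsp m → Xsp n m → Csp n → Xsp n m)
    (hA : AssumptionA 𝒲 𝒳 q θl θd Dθl Dθd)
    (v : Fin K → Csp n) (hv : Function.Injective v)
    (p : Fin K → ℝ) (hp : ∀ k, 0 < p k) (hp1 : ∑ k, p k = 1)
    (hq : q = ∑ k, ENNReal.ofReal (p k) • Measure.dirac (v k))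
    (wstar : Wsp m) (σstar : Csp n → Xsp n m)
    (hwstar : wstar ∈ 𝒲) (hσstar : IsStrategy 𝒳 q σstar) :
    SolvesVI 𝒲 𝒳 q Dθl Dθd wstar σstar ↔
      (∀ w ∈ 𝒲, ∀ σ : Fin K → Xsp n m, (∀ k, σ k ∈ 𝒳) →
        0 ≤ ∑ k, p k * (⟪w - wstar, Dθl wstar (σstar (v k))⟫ +
          ⟪σ k - σstar (v k), Dθd wstar (σstar (v k)) (v k)⟫)) := by
  subst hq
  simp only [SolvesVI, integral_sum_ofReal_smul_dirac v p fun k => (hp k).le]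
  refine ⟨fun h w hw σ hσ => ?_, fun h w hw σ hσ => h w hw (fun k => σ (v k)) fun k => hσ.2.1 _⟩
  obtain ⟨f, hfm, hf, hfv⟩ := exists_measurable_extension hv hA.X_nonempty σ hσ
  simpa only [hfv] using h w hw f ⟨hfm, hf, integrable_sum_ofReal_smul_dirac v p _⟩
end
end

section
/- Fix w ∈ ℝ^m, z ∈ ℝ^n, a matrix X ∈ ℝ^{n×m} with rows x₁, …, x_n ∈ ℝ^m, and c ∈ ℝ^n with c_i ≥ 0 for all i. Then the function F(X̄) = Σ_{i=1}^n c_i (x̄_iᵀ w − z_i)² + ‖X − X̄‖_F² (where x̄_i denotes the i-th row of X̄) attains its minimum over all X̄ ∈ ℝ^{n×m} at the unique matrix X̄⋆ whose i-th row equals x_i − (c_i (x_iᵀ w − z_i) / (1 + ‖w‖² c_i)) w for each i ∈ {1, …, n}. -/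
open scoped RealInnerProductSpace

noncomputable section

/-- Completing the square around the ridge-type minimiser `x - t • w`, where `t = c * (r - t * ‖w‖²)`
and `r` is the residual of `x`. -/
theorem weighted_residual_add_sum_sq_eq {ι : Type*} [Fintype ι] (w x b s : ι → ℝ) (z c t : ℝ)
    (ht : t = c * ((∑ j, x j * w j) - z - t * ∑ j, w j ^ 2))
    (hs : ∀ j, s j = x j - t * w j) :
    c * ((∑ j, b j * w j) - z) ^ 2 + ∑ j, (x j - b j) ^ 2 =
      c * ((∑ j, s j * w j) - z) ^ 2 + ∑ j, (x j - s j) ^ 2 +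
        (c * (∑ j, (b j - s j) * w j) ^ 2 + ∑ j, (b j - s j) ^ 2) := by
  have h_s : ∑ j, s j * w j = (∑ j, x j * w j) - t * ∑ j, w j ^ 2 := by
    rw [Finset.mul_sum, ← Finset.sum_sub_distrib]
    exact Finset.sum_congr rfl fun j _ => by rw [hs]; ring
  have h_b : ∑ j, b j * w j = (∑ j, s j * w j) + ∑ j, (b j - s j) * w j := by
    rw [← Finset.sum_add_distrib]
    exact Finset.sum_congr rfl fun j _ => by ring
  have h_sq : ∑ j, (x j - b j) ^ 2 = ∑ j, (x j - s j) ^ 2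
      - 2 * t * (∑ j, (b j - s j) * w j) + ∑ j, (b j - s j) ^ 2 := by
    rw [Finset.mul_sum, ← Finset.sum_sub_distrib, ← Finset.sum_add_distrib]
    exact Finset.sum_congr rfl fun j _ => by rw [hs]; ring
  rw [h_sq, h_b, h_s]
  linear_combination (-2 * ∑ j, (b j - s j) * w j) * ht

/-- Lemma 1 of Großhans et al., best response with a quadratic adversarial
loss.  For fixed `w ∈ ℝ^m`, `z ∈ ℝ^n`, `X ∈ ℝ^{n×m}` (with rows `x_i`) and nonnegative
weights `c_i`, the function
`F(X̄) = Σ_i c_i (x̄_iᵀ w − z_i)² + ‖X − X̄‖_F²`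
attains its minimum over `ℝ^{n×m}` at the unique matrix `X̄⋆` whose `i`-th row is
`x_i − (c_i (x_iᵀ w − z_i) / (1 + ‖w‖² c_i)) • w`.  Matrices are modeled as elements of the
Euclidean space indexed by `Fin n × Fin m`, whose norm is the Frobenius norm. -/
theorem statement11 {m n : ℕ}
    (w : EuclideanSpace ℝ (Fin m)) (z : Fin n → ℝ)
    (X : EuclideanSpace ℝ (Fin n × Fin m))
    (c : Fin n → ℝ) (hc : ∀ i, 0 ≤ c i)
    (F : EuclideanSpace ℝ (Fin n × Fin m) → ℝ)
    (hF : ∀ Xb : EuclideanSpace ℝ (Fin n × Fin m),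
      F Xb = (∑ i, c i * ((∑ j, Xb (i, j) * w j) - z i) ^ 2) + ‖X - Xb‖ ^ 2)
    (Xstar : EuclideanSpace ℝ (Fin n × Fin m))
    (hXstar : ∀ i j, Xstar (i, j) =
      X (i, j) - (c i * ((∑ j', X (i, j') * w j') - z i) / (1 + ‖w‖ ^ 2 * c i)) * w j) :
    (∀ Xb : EuclideanSpace ℝ (Fin n × Fin m), F Xstar ≤ F Xb) ∧
      (∀ Xb : EuclideanSpace ℝ (Fin n × Fin m), Xb ≠ Xstar → F Xstar < F Xb) := by
  have h_norm (A B : EuclideanSpace ℝ (Fin n × Fin m)) :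
      ‖A - B‖ ^ 2 = ∑ i, ∑ j, (A (i, j) - B (i, j)) ^ 2 := by
    rw [EuclideanSpace.real_norm_sq_eq, Fintype.sum_prod_type]
    rfl
  have h_eq (Xb : EuclideanSpace ℝ (Fin n × Fin m)) :
      F Xb = F Xstar + ((∑ i, c i * (∑ j, (Xb (i, j) - Xstar (i, j)) * w j) ^ 2)
        + ‖Xb - Xstar‖ ^ 2) := by
    rw [hF, hF, h_norm, h_norm, h_norm]
    simp only [← Finset.sum_add_distrib]
    refine Finset.sum_congr rfl fun i _ => ?_
    refine weighted_residual_add_sum_sq_eq (fun j => w j) (fun j => X (i, j))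
      (fun j => Xb (i, j)) (fun j => Xstar (i, j)) (z i) (c i) _ ?_ (hXstar i)
    have h_pos : 0 < 1 + ‖w‖ ^ 2 * c i := by
      have := hc i
      positivity
    rw [← EuclideanSpace.real_norm_sq_eq]
    linear_combination div_mul_cancel₀ (c i * ((∑ j, X (i, j) * w j) - z i)) h_pos.ne'
  have h_nonneg (Xb : EuclideanSpace ℝ (Fin n × Fin m)) :
      0 ≤ ∑ i, c i * (∑ j, (Xb (i, j) - Xstar (i, j)) * w j) ^ 2 :=
    Finset.sum_nonneg fun i _ => mul_nonneg (hc i) (sq_nonneg _)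
  refine ⟨fun Xb => ?_, fun Xb hne => ?_⟩
  · rw [h_eq Xb]
    linarith [h_nonneg Xb, sq_nonneg ‖Xb - Xstar‖]
  · rw [h_eq Xb]
    have h_pos : 0 < ‖Xb - Xstar‖ ^ 2 := pow_pos (norm_pos_iff.mpr (sub_ne_zero.mpr hne)) 2
    linarith [h_nonneg Xb]
end
end
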